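/- Let p be a polynomial of degree at most 5 and ℓ > 0. Then p'(0) = (15/(8ℓ))(p(ℓ/2) - p(-ℓ/2)) - (7/16)(p'(ℓ/2) + p'(-ℓ/2)) + (ℓ/32)(p''(ℓ/2) - p''(-ℓ/2)). -/

import Mathlib

theorem quintic_midpoint_derivative_scaled (p : Polynomial ℝ) (hp : p.degree ≤ 5)
    (ℓ : ℝ) (hℓ : 0 < ℓ) :
    p.derivative.eval 0 =
      (15 / (8 * ℓ)) * (p.eval (ℓ / 2) - p.eval (-(ℓ / 2)))
      - (7 / 16) * (p.derivative.eval (ℓ / 2) + p.derivative.eval (-(ℓ / 2)))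
      + (ℓ / 32) * ((p.derivative.derivative).eval (ℓ / 2)
          - (p.derivative.derivative).eval (-(ℓ / 2))) := by
  have hn : p.natDegree < 6 :=
    Nat.lt_succ_of_le (Polynomial.natDegree_le_of_degree_le hp)
  have hℓ' : ℓ ≠ 0 := hℓ.ne'
  rw [p.as_sum_range_C_mul_X_pow' hn]
  simp only [Finset.sum_range_succ, Finset.sum_range_zero, Polynomial.derivative_add,
    Polynomial.derivative_C_mul, Polynomial.derivative_X_pow, Polynomial.derivative_zero,
    Polynomial.eval_add, Polynomial.eval_mul, Polynomial.eval_C, Polynomial.eval_pow,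
    Polynomial.eval_X, Polynomial.eval_zero]
  norm_num
  field_simp
  ring
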